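/- arXiv:2201.06333 — 2 statements merged into one kernel-verified Lean document; each statement's English description precedes it below -/
import Mathlib

section
/- Let M be uniformly distributed on {1,...,2^{nR}} and let ρ_{MY} = Σ_m 2^{-nR} |m⟩⟨m| ⊗ ρ_m be a cq-state with (1/2)‖ρ_m − ρ_{m'}‖_1 ≤ ε for all m ≠ m'. Then the quantum mutual information satisfies I(M;Y) ≤ nεR + η(ε), where η(ε) := (ε+1)log(ε+1) − ε log ε. -/
open Matrix Finset
open scoped Kronecker ComplexOrder

/-- A density operator: positive semidefinite with unit trace. -/
def IsDensity {m : Type*} [Fintype m] [DecidableEq m] (ρ : Matrix m m ℂ) : Prop :=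
  ρ.PosSemidef ∧ ρ.trace = 1

/-- A probability distribution on a finite type. -/
def IsDist {X : Type*} [Fintype X] (P : X → ℝ) : Prop :=
  (∀ x, 0 ≤ P x) ∧ ∑ x, P x = 1

/-- von Neumann entropy (base 2) of a Hermitian matrix, via its eigenvalues. -/
noncomputable def vNEntropy {m : Type*} [Fintype m] [DecidableEq m]
    (ρ : Matrix m m ℂ) : ℝ :=
  if h : ρ.IsHermitian then ∑ i, -(h.eigenvalues i * Real.logb 2 (h.eigenvalues i)) else 0

/-- The classical-quantum state `Σ_x P(x) |x⟩⟨x| ⊗ W_x`. -/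
noncomputable def cqState {X : Type*} [Fintype X] [DecidableEq X] {m : Type*}
    [Fintype m] [DecidableEq m] (P : X → ℝ) (W : X → Matrix m m ℂ) :
    Matrix (X × m) (X × m) ℂ :=
  fun p q => if p.1 = q.1 then (P p.1 : ℂ) * W p.1 p.2 q.2 else 0

/-- Conditional entropy `H(X|Y)_P = H(XY) - H(Y)` of the cq-state `Σ_x P(x)|x⟩⟨x| ⊗ W_x`. -/
noncomputable def condEntropy {X : Type*} [Fintype X] [DecidableEq X] {m : Type*}
    [Fintype m] [DecidableEq m] (P : X → ℝ) (W : X → Matrix m m ℂ) : ℝ :=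
  vNEntropy (cqState P W) - vNEntropy (∑ x, (P x : ℂ) • W x)

/-- Trace norm of a Hermitian matrix (sum of absolute values of eigenvalues). -/
noncomputable def traceNorm {m : Type*} [Fintype m] [DecidableEq m]
    (A : Matrix m m ℂ) : ℝ :=
  if h : A.IsHermitian then ∑ i, |h.eigenvalues i| else 0

/-- `n`-fold tensor product of a family of matrices. -/
noncomputable def tensorPow {n d : ℕ} (A : Fin n → Matrix (Fin d) (Fin d) ℂ) :
    Matrix (Fin n → Fin d) (Fin n → Fin d) ℂ :=
  fun f g => ∏ i, A i (f i) (g i)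

/-- `Ξ^{(n)}_{x^n} := Σ_i I ⊗ ... ⊗ Ξ_{x_i} ⊗ ... ⊗ I`. -/
noncomputable def siteSum {n d : ℕ} (A : Fin n → Matrix (Fin d) (Fin d) ℂ) :
    Matrix (Fin n → Fin d) (Fin n → Fin d) ℂ :=
  ∑ i, (fun f g => A i (f i) (g i) * ∏ j ∈ univ.erase i, (if f j = g j then (1:ℂ) else 0))

/-- Spectral projection `{A ≥ c}` of a Hermitian matrix. -/
noncomputable def specProj {m : Type*} [Fintype m] [DecidableEq m]
    (A : Matrix m m ℂ) (c : ℝ) : Matrix m m ℂ :=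
  if h : A.IsHermitian then
    (h.eigenvectorUnitary : Matrix m m ℂ) *
      Matrix.diagonal (fun i => if c ≤ h.eigenvalues i then (1:ℂ) else 0) *
      (h.eigenvectorUnitary : Matrix m m ℂ)ᴴ
  else 0

/-- Hermitian functional calculus power `A^r` (real power of eigenvalues). -/
noncomputable def mpow {m : Type*} [Fintype m] [DecidableEq m]
    (A : Matrix m m ℂ) (r : ℝ) : Matrix m m ℂ :=
  if h : A.IsHermitian then
    (h.eigenvectorUnitary : Matrix m m ℂ) *
      Matrix.diagonal (fun i => ((h.eigenvalues i ^ r : ℝ) : ℂ)) *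
      (h.eigenvectorUnitary : Matrix m m ℂ)ᴴ
  else 0

/-- Sandwiched Rényi relative entropy of order `α` (base 2). -/
noncomputable def sandwichedRenyi {m : Type*} [Fintype m] [DecidableEq m]
    (α : ℝ) (ρ σ : Matrix m m ℂ) : ℝ :=
  (α - 1)⁻¹ *
    Real.logb 2
      ((mpow (mpow σ (-(α - 1) / (2 * α)) * ρ * mpow σ (-(α - 1) / (2 * α))) α).trace.re)

noncomputable def etaFn (ε : ℝ) : ℝ :=
  (ε + 1) * Real.logb 2 (ε + 1) - ε * Real.logb 2 ε

open scoped Matrix.Norms.L2Operator MatrixOrder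

section Helpers

variable {n : Type*} [Fintype n] [DecidableEq n]

/-- The trace of a product of two functions of Hermitian matrices, in their eigenbases. -/
lemma exists_weight_trace_cfc_mul_cfc {A B : Matrix n n ℂ}
    (hA : A.IsHermitian) (hB : B.IsHermitian) :
    ∃ w : n → n → ℝ, (∀ i j, 0 ≤ w i j) ∧ ∀ f g : ℝ → ℝ,
      (cfc f A * cfc g B).trace.re =
        ∑ i, ∑ j, f (hA.eigenvalues i) * g (hB.eigenvalues j) * w i j := by
  set W : Matrix n n ℂ := (star (hA.eigenvectorUnitary : Matrix n n ℂ)) * hB.eigenvectorUnitary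
    with hW
  refine ⟨fun i j => Complex.normSq (W i j), fun i j => Complex.normSq_nonneg _, fun f g => ?_⟩
  have key : (cfc f A * cfc g B).trace =
      (diagonal (fun i => (f (hA.eigenvalues i) : ℂ)) * W *
        diagonal (fun j => (g (hB.eigenvalues j) : ℂ)) * star W).trace := by
    rw [hA.cfc_eq, hB.cfc_eq, IsHermitian.cfc, IsHermitian.cfc, Unitary.conjStarAlgAut_apply,
      Unitary.conjStarAlgAut_apply, hW, star_mul, star_star]
    simp only [mul_assoc]
    rw [trace_mul_comm]
    simp only [mul_assoc]
    rfl
  rw [key, trace, Complex.re_sum]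
  refine sum_congr rfl fun i _ => ?_
  rw [diag_apply, mul_apply, Complex.re_sum]
  refine sum_congr rfl fun j _ => ?_
  rw [mul_diagonal, diagonal_mul]
  have : (f (hA.eigenvalues i) : ℂ) * W i j * (g (hB.eigenvalues j)) * star W j i =
      ((f (hA.eigenvalues i) * g (hB.eigenvalues j) * Complex.normSq (W i j) : ℝ) : ℂ) := by
    push_cast
    rw [← Complex.mul_conj, star_apply, RCLike.star_def]
    ring
  rw [this, Complex.ofReal_re]

/-- Klein's inequality for the relative entropy of positive definite matrices. -/
lemma Matrix.PosDef.re_trace_mul_log_le {A B : Matrix n n ℂ} (hA : A.PosDef) (hB : B.PosDef) :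
    (A * CFC.log B).trace.re ≤ (A * CFC.log A).trace.re - A.trace.re + B.trace.re := by
  obtain ⟨w, hw, h⟩ := exists_weight_trace_cfc_mul_cfc hA.1 hB.1
  have hsA : IsSelfAdjoint A := hA.1
  have hsB : IsSelfAdjoint B := hB.1
  have h1 := h id Real.log
  have h2 := h (fun x => x * Real.log x) (fun _ => 1)
  have h3 := h id (fun _ => 1)
  have h4 := h (fun _ => 1) id
  have hmul : cfc (fun x => x * Real.log x) A = A * CFC.log A := by
    rw [cfc_mul (fun x => x) Real.log A continuousOn_id (A.finite_real_spectrum.continuousOn _),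
      cfc_id' ℝ A, CFC.log]
  rw [cfc_id ℝ A, ← CFC.log] at h1
  rw [hmul, cfc_const_one ℝ B, mul_one] at h2
  rw [cfc_id ℝ A, cfc_const_one ℝ B, mul_one] at h3
  rw [cfc_const_one ℝ A, cfc_id ℝ B, one_mul] at h4
  rw [h1, h2, h3, h4, ← sum_sub_distrib, ← sum_add_distrib]
  refine sum_le_sum fun i _ => ?_
  rw [← sum_sub_distrib, ← sum_add_distrib]
  refine sum_le_sum fun j _ => ?_
  have ha := hA.eigenvalues_pos i
  have hb := hB.eigenvalues_pos j
  have hl : Real.log (hB.1.eigenvalues j / hA.1.eigenvalues i) ≤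
    hB.1.eigenvalues j / hA.1.eigenvalues i - 1 := Real.log_le_sub_one_of_pos (by positivity)
  rw [Real.log_div hb.ne' ha.ne', div_sub_one ha.ne', le_div_iff₀ ha] at hl
  simp only [id]
  nlinarith [mul_le_mul_of_nonneg_right hl (hw i j)]

lemma Matrix.PosSemidef.re_trace_mul_nonneg {A B : Matrix n n ℂ} (hA : A.PosSemidef)
    (hB : B.PosSemidef) : 0 ≤ (A * B).trace.re := by
  obtain ⟨w, hw, h⟩ := exists_weight_trace_cfc_mul_cfc hA.1 hB.1
  have hsA : IsSelfAdjoint A := hA.1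
  have hsB : IsSelfAdjoint B := hB.1
  have h1 := h id id
  rw [cfc_id ℝ A, cfc_id ℝ B] at h1
  rw [h1]
  exact sum_nonneg fun i _ => sum_nonneg fun j _ =>
    mul_nonneg (mul_nonneg (hA.eigenvalues_nonneg i) (hB.eigenvalues_nonneg j)) (hw i j)

lemma Matrix.PosSemidef.re_trace_mul_le {A B C : Matrix n n ℂ} (hA : A.PosSemidef)
    (h : B ≤ C) : (A * B).trace.re ≤ (A * C).trace.re := by
  have := hA.re_trace_mul_nonneg (Matrix.le_iff.1 h)
  rwa [mul_sub, trace_sub, Complex.sub_re, sub_nonneg] at this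

lemma Matrix.PosDef.log_mono {A B : Matrix n n ℂ} (hA : A.PosDef) (h : A ≤ B) :
    CFC.log A ≤ CFC.log B :=
  CFC.log_le_log h (isStrictlyPositive_iff_posDef.2 hA)

lemma Matrix.PosDef.re_trace_mul_log_smul {B : Matrix n n ℂ} (A : Matrix n n ℂ) (hB : B.PosDef)
    {r : ℝ} (hr : 0 < r) :
    (A * CFC.log (r • B)).trace.re = Real.log r * A.trace.re + (A * CFC.log B).trace.re := by
  rw [CFC.log_smul' B hr (isStrictlyPositive_iff_posDef.2 hB), mul_add, trace_add,
    Algebra.algebraMap_eq_smul_one]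
  simp

lemma Matrix.PosDef.re_trace_mul_log_add_le {A B : Matrix n n ℂ} (hA : A.PosDef) (hB : B.PosDef) :
    (A * CFC.log A).trace.re + (B * CFC.log B).trace.re ≤
      ((A + B) * CFC.log (A + B)).trace.re := by
  rw [add_mul, trace_add, Complex.add_re]
  refine add_le_add (hA.posSemidef.re_trace_mul_le (hA.log_mono ?_))
    (hB.posSemidef.re_trace_mul_le (hB.log_mono ?_))
  · exact le_add_of_nonneg_right hB.posSemidef.nonneg
  · exact le_add_of_nonneg_left hA.posSemidef.nonneg

lemma Matrix.PosDef.re_trace_pos {k : Type*} [Fintype k] [Nonempty k] {A : Matrix k k ℂ} (hA : A.PosDef) :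
    0 < A.trace.re := (Complex.pos_iff.1 hA.trace_pos).1

lemma Matrix.PosDef.le_re_trace_mul_log_add [Nonempty n] {A B : Matrix n n ℂ} (hA : A.PosDef)
    (hB : B.PosDef) :
    ((A + B) * CFC.log (A + B)).trace.re ≤
      (A * CFC.log A).trace.re + (B * CFC.log B).trace.re +
        ((A.trace.re + B.trace.re) * Real.log (A.trace.re + B.trace.re)
          - A.trace.re * Real.log A.trace.re - B.trace.re * Real.log B.trace.re) := by
  have ha := hA.re_trace_pos
  have hb := hB.re_trace_pos
  have hC := hA.add hB
  set a := A.trace.re with ha'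
  set b := B.trace.re with hb'
  have key : ∀ {X : Matrix n n ℂ}, X.PosDef → (X * CFC.log (A + B)).trace.re ≤
      (X * CFC.log X).trace.re - X.trace.re * (Real.log X.trace.re - Real.log (a + b)) := by
    intro X hX
    have hx := hX.re_trace_pos
    set x := X.trace.re with hx'
    have hr : 0 < x / (a + b) := by positivity
    have h := hX.re_trace_mul_log_le (hC.smul hr)
    rw [hC.re_trace_mul_log_smul X hr, trace_smul, Complex.smul_re, trace_add, Complex.add_re,
      ← ha', ← hb', ← hx', Real.log_div hx.ne' (by positivity), smul_eq_mul,
      div_mul_cancel₀ _ (by positivity)] at h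
    linarith
  have h1 := key hA
  have h2 := key hB
  rw [add_mul, trace_add, Complex.add_re]
  linarith

lemma re_trace_sum_smul_mul {ι : Type*} [Fintype ι] (p : ℝ) (F : ι → Matrix n n ℂ)
    (L : Matrix n n ℂ) :
    ((∑ m, p • F m) * L).trace.re = ∑ m, p * (F m * L).trace.re := by
  rw [Finset.sum_mul, trace_sum, Complex.re_sum]
  simp


lemma Matrix.PosDef.re_trace_sum_mul_log_le {ι : Type*} [Fintype ι] [Nonempty ι] {p : ℝ}
    (hp : 0 < p) (hp1 : Fintype.card ι * p = 1) {F : ι → Matrix n n ℂ} (hF : ∀ m, (F m).PosDef) :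
    ((∑ m, p • F m) * CFC.log (∑ m, p • F m)).trace.re ≤
      ∑ m, p * (F m * CFC.log (F m)).trace.re := by
  have hS : (∑ m, p • F m).PosDef :=
    posDef_sum univ_nonempty fun m _ => (hF m).smul hp
  rw [re_trace_sum_smul_mul]
  calc _ ≤ ∑ m, p * ((F m * CFC.log (F m)).trace.re - (F m).trace.re
        + (∑ m, p • F m).trace.re) :=
        sum_le_sum fun m _ => mul_le_mul_of_nonneg_left ((hF m).re_trace_mul_log_le hS) hp.le
    _ = _ := by
      simp only [mul_add, mul_sub, sum_add_distrib, sum_sub_distrib, sum_const, card_univ,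
        nsmul_eq_mul]
      rw [← mul_assoc, hp1, one_mul, trace_sum, Complex.re_sum]
      simp

/-- The Holevo information of the ensemble `σ + D m` is at most `log (card ι)` times the average
trace of the perturbations `D m`. -/
lemma Matrix.PosDef.holevo_add_le {ι : Type*} [Fintype ι] [Nonempty ι] {p : ℝ}
    (hp : 0 < p) (hp1 : Fintype.card ι * p = 1) {σ : Matrix n n ℂ} {D : ι → Matrix n n ℂ}
    (hσ : σ.PosDef) (hD : ∀ m, (D m).PosDef) :
    ∑ m, p * ((σ + D m) * CFC.log (σ + D m)).trace.re
      - ((∑ m, p • (σ + D m)) * CFC.log (∑ m, p • (σ + D m))).trace.re ≤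
      Real.log (Fintype.card ι) * (∑ m, p • D m).trace.re := by
  classical
  have hω : ∀ m, (σ + D m).PosDef := fun m => hσ.add (hD m)
  have hcard : (Fintype.card ι : ℝ) = p⁻¹ := eq_inv_of_mul_eq_one_left hp1
  set Ω := ∑ m, p • (σ + D m) with hΩ'
  have hΩ : Ω.PosDef := posDef_sum univ_nonempty fun m _ => (hω m).smul hp
  have hconc : ∑ m, p • CFC.log (σ + D m) ≤ CFC.log Ω := by
    refine CFC.concaveOn_log.le_map_sum (fun _ _ => hp.le) (by simpa using hp1) fun m _ => ?_
    exact isStrictlyPositive_iff_posDef.2 (hω m)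
  have h1 := hσ.posSemidef.re_trace_mul_le hconc
  have h2 : ∀ m, (D m * CFC.log (σ + D m)).trace.re ≤
      Real.log p⁻¹ * (D m).trace.re + (D m * CFC.log Ω).trace.re := by
    intro m
    rw [← hΩ.re_trace_mul_log_smul _ (inv_pos.2 hp)]
    refine (hD m).posSemidef.re_trace_mul_le ((hω m).log_mono ?_)
    have : p • (σ + D m) ≤ Ω := single_le_sum (f := fun m => p • (σ + D m))
      (fun i _ => ((hω i).smul hp).posSemidef.nonneg) (mem_univ m)
    calc σ + D m = p⁻¹ • (p • (σ + D m)) := by rw [smul_smul, inv_mul_cancel₀ hp.ne', one_smul]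
      _ ≤ _ := smul_le_smul_of_nonneg_left this (by positivity)
  have h3 : (σ * ∑ m, p • CFC.log (σ + D m)).trace.re =
      ∑ m, p * (σ * CFC.log (σ + D m)).trace.re := by
    rw [Finset.mul_sum, trace_sum, Complex.re_sum]
    simp
  have h4 : (Ω * CFC.log Ω).trace.re =
      (σ * CFC.log Ω).trace.re + ∑ m, p * (D m * CFC.log Ω).trace.re := by
    conv_lhs => rw [hΩ', re_trace_sum_smul_mul, ← hΩ']
    simp only [add_mul, trace_add, Complex.add_re, mul_add, sum_add_distrib, sum_const, card_univ,
      nsmul_eq_mul]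
    rw [← mul_assoc, hp1, one_mul]
  have h5 : ∑ m, p * (D m * CFC.log (σ + D m)).trace.re ≤
      Real.log p⁻¹ * (∑ m, p • D m).trace.re + ∑ m, p * (D m * CFC.log Ω).trace.re := by
    rw [trace_sum, Complex.re_sum, Finset.mul_sum, ← sum_add_distrib]
    refine sum_le_sum fun m _ => ?_
    have := mul_le_mul_of_nonneg_left (h2 m) hp.le
    rw [trace_smul, Complex.smul_re, smul_eq_mul]
    linarith
  rw [hcard, h4]
  simp only [add_mul, trace_add, Complex.add_re, mul_add, sum_add_distrib]
  rw [h3] at h1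
  linarith

/-- Continuity bound for the Holevo information of an ensemble of positive definite matrices
`r m` such that `r m + D' m = σ + D m`. -/
lemma Matrix.PosDef.holevo_le [Nonempty n] {ι : Type*} [Fintype ι] [Nonempty ι] {p : ℝ}
    (hp : 0 < p) (hp1 : Fintype.card ι * p = 1) {σ : Matrix n n ℂ} {r D D' : ι → Matrix n n ℂ}
    (hσ : σ.PosDef) (hr : ∀ m, (r m).PosDef) (hD : ∀ m, (D m).PosDef) (hD' : ∀ m, (D' m).PosDef)
    (h : ∀ m, r m + D' m = σ + D m) {a b : ℝ} (ha : (∑ m, p • r m).trace.re = a)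
    (hb : (∑ m, p • D m).trace.re = b) (hb' : (∑ m, p • D' m).trace.re = b) :
    ∑ m, p * (r m * CFC.log (r m)).trace.re
      - ((∑ m, p • r m) * CFC.log (∑ m, p • r m)).trace.re ≤
      Real.log (Fintype.card ι) * b
        + ((a + b) * Real.log (a + b) - a * Real.log a - b * Real.log b) := by
  have hrS : (∑ m, p • r m).PosDef := posDef_sum univ_nonempty fun m _ => (hr m).smul hp
  have hDS : (∑ m, p • D' m).PosDef := posDef_sum univ_nonempty fun m _ => (hD' m).smul hp
  have h1 : ∑ m, p * (r m * CFC.log (r m)).trace.re + ∑ m, p * (D' m * CFC.log (D' m)).trace.re ≤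
      ∑ m, p * ((σ + D m) * CFC.log (σ + D m)).trace.re := by
    rw [← sum_add_distrib]
    refine sum_le_sum fun m _ => ?_
    rw [← h m, ← mul_add]
    exact mul_le_mul_of_nonneg_left ((hr m).re_trace_mul_log_add_le (hD' m)) hp.le
  have h2 := hrS.le_re_trace_mul_log_add hDS
  rw [ha, hb', ← sum_add_distrib] at h2
  simp only [← smul_add, h] at h2
  have h3 := PosDef.re_trace_sum_mul_log_le hp hp1 hD'
  have h4 := PosDef.holevo_add_le hp hp1 hσ hD
  rw [hb] at h4
  linarith

lemma Matrix.IsHermitian.re_trace_cfc {A : Matrix n n ℂ} (hA : A.IsHermitian) (f : ℝ → ℝ) :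
    (cfc f A).trace.re = ∑ i, f (hA.eigenvalues i) := by
  rw [hA.cfc_eq, IsHermitian.cfc, Unitary.conjStarAlgAut_apply, trace_mul_comm, ← mul_assoc]
  simp [trace]

lemma vNEntropy_eq_re_trace {A : Matrix n n ℂ} (hA : A.IsHermitian) :
    vNEntropy A = -(A * CFC.log A).trace.re / Real.log 2 := by
  have hsA : IsSelfAdjoint A := hA
  have hmul : A * CFC.log A = cfc (fun x => x * Real.log x) A := by
    rw [cfc_mul (fun x => x) Real.log A continuousOn_id (A.finite_real_spectrum.continuousOn _),
      cfc_id' ℝ A, CFC.log]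
  rw [hmul, hA.re_trace_cfc, vNEntropy, dif_pos hA, ← sum_neg_distrib, sum_div]
  refine sum_congr rfl fun i _ => ?_
  rw [Real.logb]
  ring

lemma tendsto_vNEntropy_add_smul_one {A : Matrix n n ℂ} (hA : A.IsHermitian) :
    Filter.Tendsto (fun δ : ℝ => vNEntropy (A + δ • (1 : Matrix n n ℂ))) (nhdsWithin 0 (Set.Ioi 0))
      (nhds (vNEntropy A)) := by
  have hsA : IsSelfAdjoint A := hA
  have key : ∀ δ : ℝ, vNEntropy (A + δ • (1 : Matrix n n ℂ)) =
      -(∑ i, (hA.eigenvalues i + δ) * Real.log (hA.eigenvalues i + δ)) / Real.log 2 := by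
    intro δ
    have hδ : A + δ • (1 : Matrix n n ℂ) = cfc (fun x => x + δ) A := by
      rw [cfc_add_const δ (fun x => x) A, cfc_id' ℝ A, Algebra.algebraMap_eq_smul_one]
    have hB : (A + δ • (1 : Matrix n n ℂ)).IsHermitian := by
      rw [hδ]; exact cfc_predicate _ A
    rw [vNEntropy_eq_re_trace hB, ← hA.re_trace_cfc (fun x => (x + δ) * Real.log (x + δ)),
      cfc_mul (fun x => x + δ) (fun x => Real.log (x + δ)) A (by fun_prop)
        (A.finite_real_spectrum.continuousOn _), CFC.log, hδ,
      ← cfc_comp' Real.log (fun x => x + δ) A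
        ((A.finite_real_spectrum.image _).continuousOn _)]
  simp only [key]
  have h0 := key 0
  rw [zero_smul, add_zero] at h0
  rw [h0]
  refine Filter.Tendsto.mono_left (Continuous.tendsto ?_ 0) nhdsWithin_le_nhds
  refine ((continuous_finsetSum _ fun i _ => ?_).neg).div_const _
  exact Real.continuous_mul_log.comp (continuous_const.add continuous_id)

/-- Jordan decomposition of a traceless Hermitian matrix. -/
lemma Matrix.IsHermitian.exists_posSemidef_sub_eq {A : Matrix n n ℂ} (hA : A.IsHermitian)
    (h0 : A.trace = 0) : ∃ P N : Matrix n n ℂ, P.PosSemidef ∧ N.PosSemidef ∧ A = P - N ∧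
      P.trace.re = 1 / 2 * traceNorm A ∧ N.trace.re = 1 / 2 * traceNorm A := by
  have hsA : IsSelfAdjoint A := hA
  have hsub : A = cfc (fun x : ℝ => max x 0) A - cfc (fun x : ℝ => max (-x) 0) A := by
    rw [← cfc_sub (fun x : ℝ => max x 0) (fun x : ℝ => max (-x) 0) A]
    conv_lhs => rw [← cfc_id' ℝ A]
    refine cfc_congr fun x _ => ?_
    rcases le_total x 0 with h | h
    · simp [h]
    · simp [h]
  have hsum : (cfc (fun x : ℝ => max x 0) A).trace.re + (cfc (fun x : ℝ => max (-x) 0) A).trace.re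
      = traceNorm A := by
    rw [hA.re_trace_cfc, hA.re_trace_cfc, traceNorm, dif_pos hA, ← sum_add_distrib]
    refine sum_congr rfl fun i _ => ?_
    rcases le_total (hA.eigenvalues i) 0 with h | h
    · simp [h, abs_of_nonpos]
    · simp [h, abs_of_nonneg]
  have hdiff := congrArg (fun B => (trace B).re) hsub
  simp only [h0, trace_sub, Complex.sub_re, Complex.zero_re] at hdiff
  refine ⟨_, _, (cfc_nonneg fun x _ => le_max_right x 0).posSemidef,
    (cfc_nonneg fun x _ => le_max_right (-x) 0).posSemidef, hsub, ?_, ?_⟩ <;> linarith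

end Helpers

lemma etaFn_mono {s t : ℝ} (hs : 0 ≤ s) (hst : s ≤ t) : etaFn s ≤ etaFn t := by
  have h : MonotoneOn (fun x : ℝ => (x + 1) * Real.log (x + 1) - x * Real.log x) (Set.Ici 0) := by
    refine monotoneOn_of_deriv_nonneg (convex_Ici 0) ?_ ?_ ?_
    · exact ((Real.continuous_mul_log.comp (continuous_id.add continuous_const)).sub
        Real.continuous_mul_log).continuousOn
    · intro x hx
      rw [interior_Ici, Set.mem_Ioi] at hx
      have := ((Real.hasDerivAt_mul_log (x := x + 1) (by positivity)).comp_add_const x 1).sub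
        (Real.hasDerivAt_mul_log hx.ne')
      exact this.differentiableAt.differentiableWithinAt
    · intro x hx
      rw [interior_Ici, Set.mem_Ioi] at hx
      have := ((Real.hasDerivAt_mul_log (x := x + 1) (by positivity)).comp_add_const x 1).sub
        (Real.hasDerivAt_mul_log hx.ne')
      have hd := this.deriv
      have hlog := Real.log_le_log hx (by linarith : x ≤ x + 1)
      refine le_of_le_of_eq ?_ hd.symm
      linarith
  have := h hs (hs.trans hst) hst
  simp only [etaFn, Real.logb]
  have h2 : (0 : ℝ) < Real.log 2 := Real.log_pos one_lt_two
  calc _ = ((s + 1) * Real.log (s + 1) - s * Real.log s) / Real.log 2 := by ring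
    _ ≤ ((t + 1) * Real.log (t + 1) - t * Real.log t) / Real.log 2 := by gcongr
    _ = _ := by ring

/-- Continuity (Fannes-type) bound on the mutual information of an almost
indistinguishable cq-ensemble: `I(M;Y) ≤ nεR + η(ε)`. -/
theorem stmt_2 {d M : ℕ} (n : ℕ) (R ε : ℝ) (hn : 0 < n) (hR : 0 < R)
    (hM : (M : ℝ) = (2 : ℝ) ^ ((n : ℝ) * R)) (hε : ε ∈ Set.Icc (0:ℝ) 1)
    (ρ : Fin M → Matrix (Fin d) (Fin d) ℂ) (hρ : ∀ m, IsDensity (ρ m))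
    (hdist : ∀ m m', m ≠ m' → (1/2 : ℝ) * traceNorm (ρ m - ρ m') ≤ ε) :
    vNEntropy (∑ m, (M : ℂ)⁻¹ • ρ m) - ∑ m, (M : ℝ)⁻¹ * vNEntropy (ρ m)
      ≤ (n : ℝ) * ε * R + etaFn ε := by
  have hε0 := hε.1
  have hMpos : (0 : ℝ) < M := by rw [hM]; positivity
  have hM0 : 0 < M := by exact_mod_cast hMpos
  have : Nonempty (Fin M) := ⟨⟨0, hM0⟩⟩
  set m₀ : Fin M := ⟨0, hM0⟩
  have : Nonempty (Fin d) := by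
    by_contra hd
    rw [not_nonempty_iff] at hd
    have h1 := (hρ m₀).2
    rw [trace, univ_eq_empty, sum_empty] at h1
    exact zero_ne_one h1
  have hp : (0 : ℝ) < (M : ℝ)⁻¹ := inv_pos.2 hMpos
  have hp1 : (Fintype.card (Fin M) : ℝ) * (M : ℝ)⁻¹ = 1 := by
    rw [Fintype.card_fin, mul_inv_cancel₀ hMpos.ne']
  have hdec : ∀ m, ∃ P N : Matrix (Fin d) (Fin d) ℂ, P.PosSemidef ∧ N.PosSemidef ∧
      ρ m - ρ m₀ = P - N ∧ P.trace.re = N.trace.re ∧ P.trace.re ≤ ε := by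
    intro m
    by_cases hm : m = m₀
    · exact ⟨0, 0, .zero, .zero, by simp [hm], rfl, by simpa using hε0⟩
    · obtain ⟨P, N, hP, hN, hPN, h1, h2⟩ :=
        ((hρ m).1.1.sub (hρ m₀).1.1).exists_posSemidef_sub_eq
          (by rw [trace_sub, (hρ m).2, (hρ m₀).2, sub_self])
      exact ⟨P, N, hP, hN, hPN, by rw [h1, h2], by rw [h1]; exact hdist m m₀ hm⟩
  choose D D' hD hD' hDD' htr hle using hdec
  set p : ℝ := (M : ℝ)⁻¹ with hpdef
  have hsmul : ∑ m, (M : ℂ)⁻¹ • ρ m = ∑ m, p • ρ m := by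
    refine sum_congr rfl fun m _ => ?_
    ext i j
    simp [hpdef]
  rw [hsmul]
  set t : ℝ := ∑ m, p * (D m).trace.re with ht
  have hpsum : ∑ _m : Fin M, p = 1 := by
    rw [sum_const, card_univ, nsmul_eq_mul, hp1]
  have ht0 : 0 ≤ t := sum_nonneg fun m _ =>
    mul_nonneg hp.le (Complex.nonneg_iff.1 (hD m).trace_nonneg).1
  have htε : t ≤ ε := by
    calc t ≤ ∑ _m : Fin M, p * ε := sum_le_sum fun m _ => mul_le_mul_of_nonneg_left (hle m) hp.le
      _ = ε := by rw [← sum_mul, hpsum, one_mul]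
  have htrace : ∀ (F : Fin M → Matrix (Fin d) (Fin d) ℂ) (δ : ℝ),
      (∑ m, p • (F m + δ • (1 : Matrix (Fin d) (Fin d) ℂ))).trace.re =
        ∑ m, p * (F m).trace.re + d * δ := by
    intro F δ
    rw [trace_sum, Complex.re_sum]
    simp only [trace_smul, trace_add, Complex.smul_re, Complex.add_re, smul_eq_mul, mul_add,
      sum_add_distrib, ← sum_mul, hpsum, one_mul, trace_one, Fintype.card_fin, Complex.natCast_re]
    ring
  have hρbar : ∀ δ : ℝ, ∑ m, p • (ρ m + δ • (1 : Matrix (Fin d) (Fin d) ℂ)) =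
      ∑ m, p • ρ m + δ • (1 : Matrix (Fin d) (Fin d) ℂ) := by
    intro δ
    simp only [smul_add, sum_add_distrib, ← sum_smul, hpsum, one_smul]
  have hρbarH : (∑ m, p • ρ m).IsHermitian :=
    (posSemidef_sum _ fun m _ => (hρ m).1.smul hp.le).1
  have hlog2 : (0 : ℝ) < Real.log 2 := Real.log_pos one_lt_two
  set B : ℝ → ℝ := fun δ => (Real.log M * (t + d * δ) +
    ((1 + d * δ + (t + d * δ)) * Real.log (1 + d * δ + (t + d * δ))
      - (1 + d * δ) * Real.log (1 + d * δ) - (t + d * δ) * Real.log (t + d * δ))) / Real.log 2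
    with hB
  have hbound : ∀ δ : ℝ, 0 < δ →
      vNEntropy (∑ m, p • ρ m + δ • (1 : Matrix (Fin d) (Fin d) ℂ))
        - ∑ m, p * vNEntropy (ρ m + δ • (1 : Matrix (Fin d) (Fin d) ℂ)) ≤ B δ := by
    intro δ hδ
    have hpd : ∀ {A : Matrix (Fin d) (Fin d) ℂ}, A.PosSemidef →
        (A + δ • (1 : Matrix (Fin d) (Fin d) ℂ)).PosDef :=
      fun hA => PosDef.posSemidef_add hA (PosDef.one.smul hδ)
    have h := PosDef.holevo_le hp hp1 (hpd (hρ m₀).1) (fun m => hpd (hρ m).1)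
      (fun m => hpd (hD m)) (fun m => hpd (hD' m))
      (fun m => by
        have := hDD' m
        rw [sub_eq_sub_iff_add_eq_add] at this
        rw [add_add_add_comm, this, add_comm (D m), add_add_add_comm])
      (a := 1 + d * δ) (b := t + d * δ)
      (by
        rw [htrace]
        simp only [(hρ _).2, Complex.one_re, mul_one, hpsum])
      (htrace D δ)
      (by rw [htrace]; simp only [← htr]; rfl)
    rw [Fintype.card_fin, hρbar] at h
    have hH : ∀ m, (ρ m + δ • (1 : Matrix (Fin d) (Fin d) ℂ)).IsHermitian :=
      fun m => (hpd (hρ m).1).1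
    have hH' : (∑ m, p • ρ m + δ • (1 : Matrix (Fin d) (Fin d) ℂ)).IsHermitian :=
      (hpd (posSemidef_sum _ fun m _ => (hρ m).1.smul hp.le)).1
    have heq : ∀ m, p * vNEntropy (ρ m + δ • (1 : Matrix (Fin d) (Fin d) ℂ)) =
        -(p * ((ρ m + δ • (1 : Matrix (Fin d) (Fin d) ℂ)) *
          CFC.log (ρ m + δ • (1 : Matrix (Fin d) (Fin d) ℂ))).trace.re) / Real.log 2 := by
      intro m
      rw [vNEntropy_eq_re_trace (hH m)]
      ring
    simp only [heq, vNEntropy_eq_re_trace hH', hB]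
    rw [← sum_div, sum_neg_distrib, ← sub_div]
    gcongr
    linarith
  have hlim : Filter.Tendsto (fun δ : ℝ =>
      vNEntropy (∑ m, p • ρ m + δ • (1 : Matrix (Fin d) (Fin d) ℂ))
        - ∑ m, p * vNEntropy (ρ m + δ • (1 : Matrix (Fin d) (Fin d) ℂ)))
      (nhdsWithin 0 (Set.Ioi 0))
      (nhds (vNEntropy (∑ m, p • ρ m) - ∑ m, p * vNEntropy (ρ m))) :=
    (tendsto_vNEntropy_add_smul_one hρbarH).sub
      (tendsto_finsetSum _ fun m _ =>
        (tendsto_vNEntropy_add_smul_one (hρ m).1.1).const_mul p)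
  have hBlim : Filter.Tendsto B (nhdsWithin 0 (Set.Ioi 0)) (nhds (B 0)) := by
    refine Filter.Tendsto.mono_left (Continuous.tendsto ?_ 0) nhdsWithin_le_nhds
    have h1 : Continuous fun δ : ℝ => 1 + d * δ := by fun_prop
    have h2 : Continuous fun δ : ℝ => t + d * δ := by fun_prop
    exact ((continuous_const.mul h2).add (((Real.continuous_mul_log.comp (h1.add h2)).sub
      (Real.continuous_mul_log.comp h1)).sub (Real.continuous_mul_log.comp h2))).div_const _
  have hfin := le_of_tendsto_of_tendsto hlim hBlim
    (Filter.eventually_of_mem self_mem_nhdsWithin fun δ hδ => hbound δ hδ)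
  have hB0 : B 0 = n * R * t + etaFn t := by
    have hlogM : Real.log M = n * R * Real.log 2 := by rw [hM, Real.log_rpow two_pos]
    simp only [hB, hlogM, mul_zero, add_zero, Real.log_one, etaFn, Real.logb, sub_zero,
      add_comm (1 : ℝ) t]
    field_simp
  calc _ ≤ n * R * t + etaFn t := hB0 ▸ hfin
    _ ≤ n * R * ε + etaFn ε := add_le_add (by gcongr) (etaFn_mono ht0 htε)
    _ = _ := by ring
end

section
/- For an induced symmetric cq-channel on X = G/K, the uniform distribution on X maximizes the conditional entropy: sup_{P ∈ P(X)} H(X|Y)_P = H(X|Y)_{P_uniform}. -/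
open Matrix Finset
open scoped Kronecker ComplexOrder

/-- If the signed measure `c` has total mass zero and the derivative of
`t ↦ ∑ c i * log (b i + t * a i)` is nonnegative, then its value at `0` is at most its limit. -/
lemma sum_mul_log_le_of_deriv_nonneg {ι : Type*} [Fintype ι] (c a b : ι → ℝ)
    (ha : ∀ i, c i ≠ 0 → 0 < a i) (hb : ∀ i, c i ≠ 0 → 0 < b i) (hc : ∑ i, c i = 0)
    (h : ∀ t, 0 < t → 0 ≤ ∑ i, c i * (a i / (b i + t * a i))) :
    ∑ i, c i * Real.log (b i) ≤ ∑ i, c i * Real.log (a i) := by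
  have hder : ∀ t, 0 ≤ t → HasDerivAt (fun t => ∑ i, c i * Real.log (b i + t * a i))
      (∑ i, c i * (a i / (b i + t * a i))) t := by
    intro t ht
    refine HasDerivAt.fun_sum fun i _ => ?_
    by_cases hi : c i = 0
    · simpa [hi] using hasDerivAt_const t (0 : ℝ)
    · refine HasDerivAt.const_mul _ (HasDerivAt.log ?_ ?_)
      · simpa using ((hasDerivAt_id t).mul_const (a i)).const_add (b i)
      · have := ha i hi
        have := hb i hi
        positivity
  have hmono : MonotoneOn (fun t => ∑ i, c i * Real.log (b i + t * a i)) (Set.Ici 0) := by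
    refine monotoneOn_of_deriv_nonneg (convex_Ici 0)
      (fun t ht => (hder t ht).continuousAt.continuousWithinAt) ?_ ?_
    · intro t ht
      rw [interior_Ici] at ht
      exact (hder t (le_of_lt ht)).differentiableAt.differentiableWithinAt
    · intro t ht
      rw [interior_Ici] at ht
      rw [(hder t (le_of_lt ht)).deriv]
      exact h t ht
  have hlim : Filter.Tendsto (fun t : ℝ => ∑ i, c i * Real.log (b i / t + a i)) Filter.atTop
      (nhds (∑ i, c i * Real.log (a i))) := by
    refine tendsto_finsetSum _ fun i _ => ?_
    by_cases hi : c i = 0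
    · simp [hi]
    · refine Filter.Tendsto.const_mul _ (Filter.Tendsto.log ?_ (ha i hi).ne')
      simpa using (tendsto_const_nhds.div_atTop Filter.tendsto_id).add_const (a i)
  refine ge_of_tendsto hlim ?_
  filter_upwards [Filter.eventually_gt_atTop 0] with t ht
  have h0 := hmono Set.self_mem_Ici ht.le ht.le
  simp only [zero_mul, add_zero] at h0
  refine h0.trans (le_of_eq ?_)
  have : ∀ i, c i * Real.log (b i + t * a i) =
      c i * Real.log t + c i * Real.log (b i / t + a i) := by
    intro i
    by_cases hi : c i = 0
    · simp [hi]
    · have := ha i hi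
      have := hb i hi
      rw [← mul_add, ← Real.log_mul ht.ne' (by positivity)]
      congr 2
      field_simp
  simp only [this, Finset.sum_add_distrib, ← Finset.sum_mul, hc, zero_mul, zero_add]

/-- The von Neumann entropy of a unitarily diagonalized matrix. -/
lemma vNEntropy_conj_diagonal {m : Type*} [Fintype m] [DecidableEq m] (E : Matrix m m ℂ)
    (hE : Eᴴ * E = 1) (a : m → ℝ) :
    vNEntropy (E * diagonal (fun i => (a i : ℂ)) * Eᴴ) =
      (∑ i, Real.negMulLog (a i)) / Real.log 2 := by
  have hH : (E * diagonal (fun i => (a i : ℂ)) * Eᴴ).IsHermitian := by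
    refine isHermitian_mul_mul_conjTranspose _ ?_
    exact isHermitian_diagonal_of_self_adjoint _ (by ext i; simp)
  have hroots := hH.roots_charpoly_eq_eigenvalues
  have hchar : (E * diagonal (fun i => (a i : ℂ)) * Eᴴ).charpoly =
      (diagonal (fun i => (a i : ℂ))).charpoly := by
    rw [charpoly_mul_comm, ← Matrix.mul_assoc, hE, Matrix.one_mul]
  have hdiag : (diagonal (fun i => (a i : ℂ))).charpoly.roots =
      Multiset.map (fun i => (a i : ℂ)) Finset.univ.val := by
    rw [charpoly_diagonal, ← Polynomial.roots_multiset_prod_X_sub_C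
      (Multiset.map (fun i => (a i : ℂ)) Finset.univ.val), Multiset.map_map]
    simp only [Function.comp_def, Finset.prod]
  rw [hchar, hdiag] at hroots
  have hsum : ∑ i, Real.negMulLog (a i) = ∑ i, Real.negMulLog (hH.eigenvalues i) := by
    have h := congrArg (fun s => (s.map fun z : ℂ => Real.negMulLog z.re).sum) hroots
    simpa [Multiset.map_map, Function.comp_def] using h
  rw [vNEntropy, dif_pos hH, hsum, Finset.sum_div]
  refine Finset.sum_congr rfl fun i _ => ?_
  rw [Real.negMulLog, Real.logb]
  ring

/-- Positivity of `(Z - c)ᴴ V (Z - c)` for a density operator `V`. -/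
lemma two_mul_trace_le {m : Type*} [Fintype m] [DecidableEq m] {V : Matrix m m ℂ}
    (hV : IsDensity V) (Z : Matrix m m ℂ) (c : ℝ) :
    2 * c * (Zᴴ * V).trace.re - c ^ 2 ≤ (Zᴴ * V * Z).trace.re := by
  have h := (hV.1.conjTranspose_mul_mul_same (Z - (c : ℂ) • 1)).trace_nonneg
  have h' := (Complex.le_def.1 h).1
  have h2 : (V * Z).trace.re = (Zᴴ * V).trace.re := by
    have : (V * Z).trace = star (Zᴴ * V).trace := by
      rw [← trace_conjTranspose, conjTranspose_mul, conjTranspose_conjTranspose, hV.1.1.eq]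
    rw [this]; simp
  simp [sub_mul, mul_sub, hV.2] at h'
  rw [h2] at h'
  linarith

/-- Positivity of `(Z - c) V (Z - c)ᴴ` for a density operator `V`. -/
lemma two_mul_trace_le' {m : Type*} [Fintype m] [DecidableEq m] {V : Matrix m m ℂ}
    (hV : IsDensity V) (Z : Matrix m m ℂ) (c : ℝ) :
    2 * c * (Zᴴ * V).trace.re - c ^ 2 ≤ (Z * V * Zᴴ).trace.re := by
  have h := two_mul_trace_le hV Zᴴ c
  have h2 : (Z * V).trace.re = (Zᴴ * V).trace.re := by
    have : (Z * V).trace = star (Zᴴ * V).trace := by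
      rw [← trace_conjTranspose, conjTranspose_mul, conjTranspose_conjTranspose, hV.1.1.eq,
        trace_mul_comm]
    rw [this]; simp
  rwa [conjTranspose_conjTranspose, h2] at h

/-- The resolvent form of the relative entropy is a supremum over `Z` of linear functions of the
pair of states; on mixtures each of them is bounded by its classical counterpart. -/
lemma variational_le {X m : Type*} [Fintype X] [Fintype m] [DecidableEq m]
    {V : X → Matrix m m ℂ} (hV : ∀ x, IsDensity (V x)) {P Q : X → ℝ} (hP : ∀ x, 0 ≤ P x)
    (hQ : ∀ x, 0 < Q x) (Z : Matrix m m ℂ) {t : ℝ} (ht : 0 < t) :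
    2 * (Zᴴ * ∑ x, (P x : ℂ) • V x).trace.re - (Zᴴ * (∑ x, (Q x : ℂ) • V x) * Z).trace.re
      - t * (Z * (∑ x, (P x : ℂ) • V x) * Zᴴ).trace.re ≤
      ∑ x, P x * (P x / (Q x + t * P x)) := by
  simp only [Finset.mul_sum, Finset.sum_mul, trace_sum, Complex.re_sum, Matrix.mul_smul,
    Matrix.smul_mul, trace_smul, smul_eq_mul, Complex.re_ofReal_mul, ← Finset.sum_sub_distrib]
  refine Finset.sum_le_sum fun x _ => ?_
  have hpos : 0 < Q x + t * P x := by have := hP x; have := hQ x; positivity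
  set c := P x / (Q x + t * P x) with hc
  have e : c * (Q x + t * P x) = P x := div_mul_cancel₀ _ hpos.ne'
  have h1 := mul_le_mul_of_nonneg_left (two_mul_trace_le (hV x) Z c) (hQ x).le
  have h2 := mul_le_mul_of_nonneg_left (two_mul_trace_le' (hV x) Z c)
    (mul_nonneg ht.le (hP x))
  have e2 : P x * c = c ^ 2 * (Q x + t * P x) := by
    calc P x * c = c * (Q x + t * P x) * c := by rw [e]
      _ = _ := by ring
  have e3 : 2 * (P x * (Zᴴ * V x).trace.re) =
    2 * ((c * (Q x + t * P x)) * (Zᴴ * V x).trace.re) := by rw [e]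
  rw [e2, e3]
  nlinarith

/-- Monotonicity of the relative entropy under the preparation channel `x ↦ V x`, written in
eigenbases of the two output states. -/
lemma relEntropy_preparation_le {X m : Type*} [Fintype X] [Fintype m] [DecidableEq m]
    {V : X → Matrix m m ℂ} (hV : ∀ x, IsDensity (V x)) {P Q : X → ℝ} (hP : ∀ x, 0 ≤ P x)
    (hQ : ∀ x, 0 < Q x) {E F : Matrix m m ℂ} (hE : Eᴴ * E = 1) (hF : Fᴴ * F = 1)
    {a b : m → ℝ} (ha : ∀ i, 0 ≤ a i) (hb : ∀ i, 0 ≤ b i)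
    (hA : ∑ x, (P x : ℂ) • V x = E * diagonal (fun i => (a i : ℂ)) * Eᴴ)
    (hB : ∑ x, (Q x : ℂ) • V x = F * diagonal (fun i => (b i : ℂ)) * Fᴴ) :
    ∑ i, a i * Real.log (a i) -
      ∑ j, ((Fᴴ * (∑ x, (P x : ℂ) • V x) * F) j j).re * Real.log (b j) ≤
      ∑ x, P x * Real.log (P x) - ∑ x, P x * Real.log (Q x) := by
  have hF' : F * Fᴴ = 1 := mul_eq_one_comm.mp hF
  set C : Matrix m m ℂ := Fᴴ * E with hC
  have hCC : Cᴴ * C = 1 := by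
    rw [hC, conjTranspose_mul, conjTranspose_conjTranspose, Matrix.mul_assoc,
      ← Matrix.mul_assoc F, hF', Matrix.one_mul, hE]
  set w : m → m → ℝ := fun j i => Complex.normSq (C j i) with hw
  have hw0 : ∀ j i, 0 ≤ w j i := fun j i => Complex.normSq_nonneg _
  have hw1 : ∀ i, ∑ j, w j i = 1 := by
    intro i
    have h := congrArg Complex.re (congrFun (congrFun hCC i) i)
    simp only [mul_apply, conjTranspose_apply, one_apply_eq, Complex.re_sum, Complex.one_re] at h
    rw [← h]
    refine Finset.sum_congr rfl fun j _ => ?_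
    simp [hw, Complex.normSq_apply]
  have hdiag : ∀ j, ((Fᴴ * (∑ x, (P x : ℂ) • V x) * F) j j).re = ∑ i, w j i * a i := by
    intro j
    have : Fᴴ * (∑ x, (P x : ℂ) • V x) * F = C * diagonal (fun i => (a i : ℂ)) * Cᴴ := by
      rw [hA, hC, conjTranspose_mul, conjTranspose_conjTranspose]
      simp only [Matrix.mul_assoc]
    rw [this, mul_apply, Complex.re_sum]
    refine Finset.sum_congr rfl fun i _ => ?_
    simp [mul_diagonal, hw, Complex.normSq_apply]
    ring
  have hbdiag : ∀ j, ((Fᴴ * (∑ x, (Q x : ℂ) • V x) * F) j j).re = b j := by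
    intro j
    have : Fᴴ * (∑ x, (Q x : ℂ) • V x) * F = diagonal (fun i => (b i : ℂ)) := by
      rw [hB]
      calc _ = (Fᴴ * F) * diagonal (fun i => (b i : ℂ)) * (Fᴴ * F) := by
            simp only [Matrix.mul_assoc]
        _ = _ := by simp [hF]
    rw [this, diagonal_apply_eq, Complex.ofReal_re]
  have hexp : ∀ (R : X → ℝ) j, ((Fᴴ * (∑ x, (R x : ℂ) • V x) * F) j j).re =
      ∑ x, R x * ((Fᴴ * V x * F) j j).re := by
    intro R j
    simp only [Finset.mul_sum, Finset.sum_mul, Matrix.mul_smul, Matrix.smul_mul,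
      Matrix.sum_apply, Matrix.smul_apply, smul_eq_mul, Complex.re_sum, Complex.re_ofReal_mul]
  have hv0 : ∀ x j, 0 ≤ ((Fᴴ * V x * F) j j).re := fun x j =>
    (Complex.le_def.1 ((hV x).1.conjTranspose_mul_mul_same F).diag_nonneg).1
  have hsupp : ∀ j i, w j i * a i ≠ 0 → 0 < a i ∧ 0 < b j := by
    intro j i hne
    refine ⟨lt_of_le_of_ne (ha i) fun h => hne (by simp [← h]), lt_of_le_of_ne (hb j) fun h => ?_⟩
    have h0 : ∑ x, Q x * ((Fᴴ * V x * F) j j).re = 0 := by rw [← hexp, hbdiag, h]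
    have h1 := (Finset.sum_eq_zero_iff_of_nonneg
      fun x _ => mul_nonneg (hQ x).le (hv0 x j)).1 h0
    have h2 : ∑ i, w j i * a i = 0 := by
      rw [← hdiag, hexp]
      refine Finset.sum_eq_zero fun x hx => ?_
      rw [(mul_eq_zero.1 (h1 x hx)).resolve_left (hQ x).ne', mul_zero]
    exact hne ((Finset.sum_eq_zero_iff_of_nonneg
      fun i _ => mul_nonneg (hw0 j i) (ha i)).1 h2 i (Finset.mem_univ i))
  have hmass : ∑ x, P x = ∑ i, a i := by
    have h := congrArg (fun M => (trace M).re) hA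
    rw [trace_mul_comm, ← Matrix.mul_assoc, hE, Matrix.one_mul] at h
    simpa [trace_sum, (hV _).2, trace_diagonal] using h
  have hmass' : ∑ p : m × m, w p.1 p.2 * a p.2 = ∑ i, a i := by
    rw [Fintype.sum_prod_type_right]
    simp only [← Finset.sum_mul, hw1, one_mul]
  have key := sum_mul_log_le_of_deriv_nonneg (ι := X ⊕ (m × m))
    (Sum.elim P fun p => -(w p.1 p.2 * a p.2)) (Sum.elim P fun p => a p.2)
    (Sum.elim Q fun p => b p.1) ?_ ?_ ?_ ?_
  · simp only [Fintype.sum_sum_type, Sum.elim_inl, Sum.elim_inr, neg_mul,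
      Finset.sum_neg_distrib] at key
    have e1 : ∑ p : m × m, w p.1 p.2 * a p.2 * Real.log (a p.2) =
        ∑ i, a i * Real.log (a i) := by
      rw [Fintype.sum_prod_type_right]
      simp only [← Finset.sum_mul, hw1, one_mul]
    have e2 : ∑ p : m × m, w p.1 p.2 * a p.2 * Real.log (b p.1) =
        ∑ j, ((Fᴴ * (∑ x, (P x : ℂ) • V x) * F) j j).re * Real.log (b j) := by
      rw [Fintype.sum_prod_type]
      simp only [hdiag, Finset.sum_mul]
    rw [e1, e2] at key
    linarith
  · rintro (x | p) h
    · exact lt_of_le_of_ne (hP x) (Ne.symm h)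
    · exact (hsupp p.1 p.2 (neg_ne_zero.1 h)).1
  · rintro (x | p) h
    · exact hQ x
    · exact (hsupp p.1 p.2 (neg_ne_zero.1 h)).2
  · simp [Fintype.sum_sum_type, hmass, hmass']
  · intro t ht
    simp only [Fintype.sum_sum_type, Sum.elim_inl, Sum.elim_inr, neg_mul,
      Finset.sum_neg_distrib, ← sub_eq_add_neg, sub_nonneg]
    set K : Matrix m m ℂ := of fun j i => ((a i / (b j + t * a i) : ℝ) : ℂ) * C j i with hK
    refine le_trans (le_of_eq ?_) (variational_le hV hP hQ (F * K * Eᴴ) ht)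
    have t1 : ((F * K * Eᴴ)ᴴ * ∑ x, (P x : ℂ) • V x).trace =
        (Kᴴ * (C * diagonal (fun i => (a i : ℂ)))).trace := by
      rw [hA, hC, conjTranspose_mul, conjTranspose_mul, conjTranspose_conjTranspose]
      calc _ = (E * (Kᴴ * (Fᴴ * E * diagonal (fun i => (a i : ℂ))) * Eᴴ)).trace := by
            simp only [Matrix.mul_assoc]
        _ = _ := by rw [trace_mul_comm, Matrix.mul_assoc, hE, Matrix.mul_one]
    have t2 : ((F * K * Eᴴ)ᴴ * (∑ x, (Q x : ℂ) • V x) * (F * K * Eᴴ)).trace =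
        (Kᴴ * (diagonal (fun i => (b i : ℂ)) * K)).trace := by
      rw [hB, conjTranspose_mul, conjTranspose_mul, conjTranspose_conjTranspose]
      calc _ = (E * (Kᴴ * ((Fᴴ * F) * diagonal (fun i => (b i : ℂ)) * (Fᴴ * F) * K)
              * Eᴴ)).trace := by simp only [Matrix.mul_assoc]
        _ = _ := by
          rw [trace_mul_comm, Matrix.mul_assoc, hE, hF, Matrix.mul_one, Matrix.one_mul,
            Matrix.mul_one]
    have t3 : ((F * K * Eᴴ) * (∑ x, (P x : ℂ) • V x) * (F * K * Eᴴ)ᴴ).trace =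
        (Kᴴ * (K * diagonal (fun i => (a i : ℂ)))).trace := by
      rw [hA, conjTranspose_mul, conjTranspose_mul, conjTranspose_conjTranspose]
      calc _ = (F * (K * ((Eᴴ * E) * diagonal (fun i => (a i : ℂ)) * (Eᴴ * E) * Kᴴ)
              * Fᴴ)).trace := by simp only [Matrix.mul_assoc]
        _ = _ := by
          rw [trace_mul_comm, Matrix.mul_assoc, hE, hF, Matrix.mul_one, Matrix.one_mul,
            Matrix.mul_one, ← Matrix.mul_assoc, trace_mul_comm]
    rw [t1, t2, t3, Fintype.sum_prod_type_right]
    simp only [trace, diag_apply, mul_apply (M := Kᴴ), Complex.re_sum, Finset.mul_sum,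
      ← Finset.sum_sub_distrib]
    refine Finset.sum_congr rfl fun i _ => Finset.sum_congr rfl fun j _ => ?_
    have hs : (a i / (b j + t * a i)) * (b j + t * a i) = a i := by
      by_cases h : b j + t * a i = 0
      · have := hb j
        have := mul_nonneg ht.le (ha i)
        have h' : t * a i = 0 := by linarith
        rw [(mul_eq_zero.1 h').resolve_left ht.ne']
        simp
      · exact div_mul_cancel₀ _ h
    simp only [conjTranspose_apply, mul_diagonal, diagonal_mul, hK, of_apply]
    generalize a i / (b j + t * a i) = s at hs
    simp only [hw, Complex.normSq_apply, Complex.star_def, map_mul, Complex.conj_ofReal,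
      Complex.mul_re, Complex.mul_im, Complex.ofReal_re, Complex.ofReal_im, Complex.conj_re,
      Complex.conj_im]
    linear_combination s * ((C j i).re * (C j i).re + (C j i).im * (C j i).im) * hs

lemma cqState_mul {X m : Type*} [Fintype X] [DecidableEq X] [Fintype m] [DecidableEq m]
    (P Q : X → ℝ) (A B : X → Matrix m m ℂ) :
    cqState P A * cqState Q B = cqState (P * Q) (A * B) := by
  ext ⟨x, i⟩ ⟨y, j⟩
  simp only [mul_apply, cqState, Fintype.sum_prod_type, Pi.mul_apply]
  rw [Finset.sum_eq_single x]
  · by_cases h : x = y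
    · subst h
      simp only [if_true, Finset.mul_sum, Complex.ofReal_mul]
      exact Finset.sum_congr rfl fun k _ => by ring
    · simp [h]
  · intro z _ hz
    simp [Ne.symm hz]
  · simp

lemma cqState_conjTranspose {X m : Type*} [Fintype X] [DecidableEq X] [Fintype m] [DecidableEq m]
    (P : X → ℝ) (A : X → Matrix m m ℂ) :
    (cqState P A)ᴴ = cqState P (fun x => (A x)ᴴ) := by
  ext ⟨x, i⟩ ⟨y, j⟩
  by_cases h : x = y
  · subst h; simp [cqState]
  · simp [cqState, h, Ne.symm h]

lemma cqState_diagonal {X m : Type*} [Fintype X] [DecidableEq X] [Fintype m] [DecidableEq m]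
    (P : X → ℝ) (l : m → ℝ) :
    cqState P (fun _ => diagonal (fun i => (l i : ℂ))) =
      diagonal (fun p : X × m => ((P p.1 * l p.2 : ℝ) : ℂ)) := by
  ext ⟨x, i⟩ ⟨y, j⟩
  by_cases h : x = y <;> by_cases h' : i = j <;> simp [cqState, h, h']

/-- The chain rule `H(XY) = H(X) + H(Y|X)` for states `V x` with common spectrum `l`. -/
lemma vNEntropy_cqState {X m : Type*} [Fintype X] [DecidableEq X] [Fintype m] [DecidableEq m]
    {P : X → ℝ} (hP : ∑ x, P x = 1) {l : m → ℝ} (hl : ∑ i, l i = 1) {F V : X → Matrix m m ℂ}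
    (hF : ∀ x, (F x)ᴴ * F x = 1)
    (hV : ∀ x, V x = F x * diagonal (fun i => (l i : ℂ)) * (F x)ᴴ) :
    vNEntropy (cqState P V) =
      (∑ x, Real.negMulLog (P x) + ∑ i, Real.negMulLog (l i)) / Real.log 2 := by
  have h1 : cqState P V = cqState 1 F * diagonal (fun p : X × m => ((P p.1 * l p.2 : ℝ) : ℂ)) *
      (cqState 1 F)ᴴ := by
    rw [← cqState_diagonal, cqState_conjTranspose, cqState_mul, cqState_mul, one_mul, mul_one]
    congr 1
    exact funext hV
  have h2 : (cqState 1 F)ᴴ * cqState 1 F = 1 := by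
    rw [cqState_conjTranspose, cqState_mul, ← diagonal_one]
    have := cqState_diagonal (1 : X → ℝ) (1 : m → ℝ)
    simp only [Pi.one_apply, mul_one, Complex.ofReal_one] at this
    rw [← this, mul_one]
    congr 1
    funext x
    simp [hF]
  rw [h1, vNEntropy_conj_diagonal _ h2, Fintype.sum_prod_type]
  simp only [Real.negMulLog_mul, Finset.sum_add_distrib, ← Finset.sum_mul, ← Finset.mul_sum, hl,
    hP, one_mul]

/-- A matrix commuting with `F diag(b) Fᴴ` commutes with `F diag(f ∘ b) Fᴴ`. -/
lemma commute_conj_diagonal {m : Type*} [Fintype m] [DecidableEq m] {F M : Matrix m m ℂ}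
    (hF : Fᴴ * F = 1) (b : m → ℝ) (f : ℝ → ℝ)
    (h : M * (F * diagonal (fun i => (b i : ℂ)) * Fᴴ) =
      F * diagonal (fun i => (b i : ℂ)) * Fᴴ * M) :
    M * (F * diagonal (fun i => (f (b i) : ℂ)) * Fᴴ) =
      F * diagonal (fun i => (f (b i) : ℂ)) * Fᴴ * M := by
  have hF' : F * Fᴴ = 1 := mul_eq_one_comm.mp hF
  set K := Fᴴ * M * F with hK
  have hM : M = F * K * Fᴴ := by
    calc M = (F * Fᴴ) * M * (F * Fᴴ) := by simp [hF']
      _ = _ := by simp only [hK, Matrix.mul_assoc]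
  have h1 : K * diagonal (fun i => (b i : ℂ)) = diagonal (fun i => (b i : ℂ)) * K := by
    calc K * diagonal (fun i => (b i : ℂ)) =
          Fᴴ * (M * (F * diagonal (fun i => (b i : ℂ)) * Fᴴ)) * F := by
            simp only [hK, Matrix.mul_assoc, hF, Matrix.mul_one]
      _ = (Fᴴ * F) * diagonal (fun i => (b i : ℂ)) * K := by
            rw [h]; simp only [hK, Matrix.mul_assoc]
      _ = _ := by rw [hF, Matrix.one_mul]
  have h2 : K * diagonal (fun i => (f (b i) : ℂ)) = diagonal (fun i => (f (b i) : ℂ)) * K := by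
    ext i j
    have h3 := congrFun (congrFun h1 i) j
    rw [mul_diagonal, diagonal_mul, mul_comm] at h3 ⊢
    rcases mul_eq_mul_right_iff.1 h3 with h4 | h4
    · rw [Complex.ofReal_injective h4]
    · simp [h4]
  calc M * (F * diagonal (fun i => (f (b i) : ℂ)) * Fᴴ) =
        F * (K * (Fᴴ * F) * diagonal (fun i => (f (b i) : ℂ))) * Fᴴ := by
          nth_rw 1 [hM]; simp only [Matrix.mul_assoc]
    _ = F * diagonal (fun i => (f (b i) : ℂ)) * (Fᴴ * F) * K * Fᴴ := by
          rw [hF, Matrix.mul_one, h2, Matrix.mul_one]; simp only [Matrix.mul_assoc]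
    _ = _ := by
          conv_rhs => rw [hM]
          simp only [Matrix.mul_assoc]

lemma exists_conj_diagonal_eq {m : Type*} [Fintype m] [DecidableEq m]
    {A : Matrix m m ℂ} (hA : A.PosSemidef) :
    ∃ (E : Matrix m m ℂ) (a : m → ℝ), Eᴴ * E = 1 ∧ (∀ i, 0 ≤ a i) ∧
      A = E * diagonal (fun i => (a i : ℂ)) * Eᴴ := by
  refine ⟨hA.1.eigenvectorUnitary, hA.1.eigenvalues, ?_, hA.eigenvalues_nonneg, ?_⟩
  · exact mem_unitaryGroup_iff'.1 hA.1.eigenvectorUnitary.2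
  · have := hA.1.spectral_theorem
    rw [Unitary.conjStarAlgAut_apply] at this
    exact this

/-- For an induced symmetric cq-channel, the uniform distribution maximizes the
conditional entropy `H(X|Y)_P`. -/
theorem stmt_5 {G : Type*} [Group G] [Fintype G] [DecidableEq G] {d : ℕ}
    (U : G → Matrix (Fin d) (Fin d) ℂ)
    (hU1 : U 1 = 1)
    (hUuni : ∀ g, U g ∈ Matrix.unitaryGroup (Fin d) ℂ)
    (hproj : ∀ g g', ∃ θ : ℝ, U g * U g' = Complex.exp (θ * Complex.I) • U (g * g'))
    (ρ : Matrix (Fin d) (Fin d) ℂ) (hρ : IsDensity ρ)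
    (W : G → Matrix (Fin d) (Fin d) ℂ) (hWdef : ∀ g, W g = U g * ρ * (U g)ᴴ)
    {X : Type*} [Fintype X] [DecidableEq X]
    (π : G → X) (hπsurj : Function.Surjective π)
    (hπ : ∀ g g', π g = π g' ↔ W g = W g')
    (V : X → Matrix (Fin d) (Fin d) ℂ) (hV : ∀ g, V (π g) = W g) :
    IsGreatest {h : ℝ | ∃ P : X → ℝ, IsDist P ∧ h = condEntropy P V}
      (condEntropy (fun _ : X => (Fintype.card X : ℝ)⁻¹) V) := by
  have hUU : ∀ g, (U g)ᴴ * U g = 1 := fun g => mem_unitaryGroup_iff'.1 (hUuni g)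
  have hUU' : ∀ g, U g * (U g)ᴴ = 1 := fun g => mem_unitaryGroup_iff.1 (hUuni g)
  have hVconj : ∀ g h, V (π (g * h)) = U g * V (π h) * (U g)ᴴ := by
    intro g h
    obtain ⟨θ, hθ⟩ := hproj g h
    have hphase : Complex.exp (θ * Complex.I) * star (Complex.exp (θ * Complex.I)) = 1 := by
      rw [Complex.star_def, Complex.mul_conj, Complex.normSq_eq_norm_sq,
        Complex.norm_exp_ofReal_mul_I]
      simp
    rw [hV, hV, hWdef, hWdef]
    calc U (g * h) * ρ * (U (g * h))ᴴ = (Complex.exp (θ * Complex.I) *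
          star (Complex.exp (θ * Complex.I))) • (U (g * h) * ρ * (U (g * h))ᴴ) := by
            rw [hphase, one_smul]
      _ = (U g * U h) * ρ * (U g * U h)ᴴ := by
            rw [hθ, conjTranspose_smul]
            simp only [Matrix.smul_mul, Matrix.mul_smul, smul_smul]
            rw [mul_comm]
      _ = _ := by rw [conjTranspose_mul]; simp only [Matrix.mul_assoc]
  have hVinj : Function.Injective V := by
    intro x y hxy
    obtain ⟨g, rfl⟩ := hπsurj x
    obtain ⟨h, rfl⟩ := hπsurj y
    rw [hV, hV] at hxy
    exact (hπ g h).2 hxy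
  have hVρ : ∀ x, ∃ g, V x = U g * ρ * (U g)ᴴ := by
    intro x
    obtain ⟨g, rfl⟩ := hπsurj x
    exact ⟨g, by rw [hV, hWdef]⟩
  have hVdens : ∀ x, IsDensity (V x) := by
    intro x
    obtain ⟨g, hg⟩ := hVρ x
    refine ⟨hg ▸ hρ.1.mul_mul_conjTranspose_same (U g), ?_⟩
    rw [hg, trace_mul_comm, ← Matrix.mul_assoc, hUU, Matrix.one_mul, hρ.2]
  have : Nonempty X := ⟨π 1⟩
  have hcard : (0 : ℝ) < Fintype.card X := by exact_mod_cast Fintype.card_pos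
  have hu : IsDist (fun _ : X => (Fintype.card X : ℝ)⁻¹) := by
    refine ⟨fun _ => by positivity, ?_⟩
    rw [Finset.sum_const, Finset.card_univ, nsmul_eq_mul, mul_inv_cancel₀ hcard.ne']
  have hsumV : ∀ g, U g * (∑ x, V x) * (U g)ᴴ = ∑ x, V x := by
    intro g
    choose s hs using hπsurj
    have hτ : ∀ x, V (π (g * s x)) = U g * V x * (U g)ᴴ := fun x => by rw [hVconj, hs]
    have hinj : Function.Injective fun x => π (g * s x) := by
      intro x y hxy
      have h1 : U g * V x * (U g)ᴴ = U g * V y * (U g)ᴴ := by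
        rw [← hτ, ← hτ]; exact congrArg V hxy
      apply hVinj
      have h2 := congrArg (fun M => (U g)ᴴ * M * U g) h1
      simpa only [← Matrix.mul_assoc, hUU, Matrix.one_mul, Matrix.mul_assoc _ _ (U g),
        Matrix.mul_one] using h2
    rw [Finset.mul_sum, Finset.sum_mul, ← (Finite.injective_iff_bijective.1 hinj).sum_comp V]
    exact Finset.sum_congr rfl fun x _ => (hτ x).symm
  have hpsd : ∀ P : X → ℝ, IsDist P → (∑ x, (P x : ℂ) • V x).PosSemidef := fun P hP =>
    posSemidef_sum _ fun x _ => (hVdens x).1.smul (by exact_mod_cast hP.1 x)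
  obtain ⟨R, l, hR, -, hl⟩ := exists_conj_diagonal_eq hρ.1
  have hl1 : ∑ i, l i = 1 := by
    have h := congrArg Complex.re hρ.2
    rw [hl, trace_mul_comm, ← Matrix.mul_assoc, hR, Matrix.one_mul, trace_diagonal] at h
    simpa using h
  choose γ hγ using hVρ
  have hchain : ∀ P : X → ℝ, IsDist P → vNEntropy (cqState P V) =
      (∑ x, Real.negMulLog (P x) + ∑ i, Real.negMulLog (l i)) / Real.log 2 := by
    intro P hP
    refine vNEntropy_cqState (F := fun x => U (γ x) * R) hP.2 hl1 (fun x => ?_) fun x => ?_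
    · rw [conjTranspose_mul, Matrix.mul_assoc, ← Matrix.mul_assoc _ (U _), hUU, Matrix.one_mul,
        hR]
    · rw [hγ, hl, conjTranspose_mul]
      simp only [Matrix.mul_assoc]
  refine ⟨⟨_, hu, rfl⟩, ?_⟩
  rintro _ ⟨P, hP, rfl⟩
  obtain ⟨E, a, hE, ha, hA⟩ := exists_conj_diagonal_eq (hpsd P hP)
  obtain ⟨F, b, hF, hb, hB⟩ := exists_conj_diagonal_eq (hpsd _ hu)
  have hrel := relEntropy_preparation_le hVdens hP.1 (fun _ => inv_pos.2 hcard) hE hF ha hb hA hB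
  set L := F * diagonal (fun i => (Real.log (b i) : ℂ)) * Fᴴ with hL
  have hLcomm : ∀ g, U g * L = L * U g := by
    intro g
    refine commute_conj_diagonal hF b Real.log ?_
    rw [← hB, ← Finset.smul_sum, Matrix.mul_smul, Matrix.smul_mul]
    congr 1
    nth_rw 2 [← hsumV g]
    rw [Matrix.mul_assoc _ _ (U g), hUU, Matrix.mul_one]
  have hVL : ∀ x, (V x * L).trace = (ρ * L).trace := by
    intro x
    rw [hγ, Matrix.mul_assoc, Matrix.mul_assoc, trace_mul_comm]
    calc _ = (ρ * ((U (γ x))ᴴ * (L * U (γ x)))).trace := by simp only [Matrix.mul_assoc]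
      _ = _ := by rw [← hLcomm, ← Matrix.mul_assoc _ (U _), hUU, Matrix.one_mul]
  have hmix : ∀ S : X → ℝ, IsDist S →
      ((∑ x, (S x : ℂ) • V x) * L).trace = (ρ * L).trace := by
    intro S hS
    simp only [Finset.sum_mul, Matrix.smul_mul, trace_sum, trace_smul, hVL]
    rw [← Finset.sum_smul, ← Complex.ofReal_sum, hS.2, Complex.ofReal_one, one_smul]
  have hcross : ∀ M : Matrix (Fin d) (Fin d) ℂ,
      ∑ j, ((Fᴴ * M * F) j j).re * Real.log (b j) = (M * L).trace.re := by
    intro M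
    have : (M * L).trace = (Fᴴ * M * F * diagonal (fun i => (Real.log (b i) : ℂ))).trace := by
      rw [hL, ← Matrix.mul_assoc, trace_mul_comm]
      simp only [Matrix.mul_assoc]
    rw [this, trace, Complex.re_sum]
    refine Finset.sum_congr rfl fun j _ => ?_
    rw [diag_apply, mul_diagonal, Complex.re_mul_ofReal]
  have hself : ∑ j, b j * Real.log (b j) = (ρ * L).trace.re := by
    rw [← hmix _ hu, ← hcross, hB]
    refine Finset.sum_congr rfl fun j _ => ?_
    have : Fᴴ * (F * diagonal (fun i => (b i : ℂ)) * Fᴴ) * F =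
        diagonal (fun i => (b i : ℂ)) := by
      calc _ = (Fᴴ * F) * diagonal (fun i => (b i : ℂ)) * (Fᴴ * F) := by
            simp only [Matrix.mul_assoc]
        _ = _ := by rw [hF, Matrix.one_mul, Matrix.mul_one]
    rw [this, diagonal_apply_eq, Complex.ofReal_re]
  rw [hcross, hmix P hP, ← hself, ← Finset.sum_mul, hP.2, one_mul] at hrel
  have huniform : ∑ _x : X, Real.negMulLog ((Fintype.card X : ℝ)⁻¹) =
      -Real.log ((Fintype.card X : ℝ)⁻¹) := by
    rw [← one_mul (Real.log _), ← hu.2, Finset.sum_mul, ← Finset.sum_neg_distrib]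
    exact Finset.sum_congr rfl fun _ _ => by rw [Real.negMulLog, neg_mul]
  rw [condEntropy, condEntropy, hchain P hP, hchain _ hu, hA, hB, vNEntropy_conj_diagonal E hE,
    vNEntropy_conj_diagonal F hF, ← sub_div, ← sub_div, huniform]
  refine div_le_div_of_nonneg_right ?_ (Real.log_pos one_lt_two).le
  simp only [Real.negMulLog, neg_mul, Finset.sum_neg_distrib]
  linarith
end
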